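/- arXiv:2106.12006 — 3 statements merged into one kernel-verified Lean document; each statement's English description precedes it below -/
import Mathlib

section
/- Let m ≥ 1, n ≥ 0 be integers and x, y, ξ, η ∈ ℂ with x ≠ 0, Re(ξ/x) < 1, Im(η − ξy/x) > 0, and i(y + kx) ∉ [0,∞) for every k ∈ ℤ. Then the function ξ' ↦ J_{m,n}(x,y,ξ',η) is complex-differentiable at ξ, with derivative ∂_ξ J_{m,n}(x,y,ξ,η) = (2π/x) · J_{m−1,n+1}(x,y,ξ,η) + (2πi y/x) · J_{m−1,n}(x,y,ξ,η). -/
open MeasureTheory Real Filter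

/-- The polylogarithm `Li_p(w) = ∑_{j ≥ 1} w^j / j^p`, for integer index `p`. -/
noncomputable def Li (p : ℤ) (w : ℂ) : ℂ := ∑' j : ℕ, w ^ (j + 1) / ((j : ℂ) + 1) ^ p

/-- The integrand in the definition of `J_{m,n}(x,y,ξ,η)`. -/
noncomputable def Jfun (m n : ℕ) (x y ξ η : ℂ) (s : ℝ) : ℂ :=
  (s : ℂ) ^ n *
      Li m (Complex.exp (-(2 * (π : ℂ)) * (1 - ξ / x) * s +
        2 * (π : ℂ) * Complex.I * (η - ξ * y / x))) /
    Complex.tanh ((π : ℂ) * ((s : ℂ) - Complex.I * y) / x)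

/-- The function `J_{m,n}(x,y,ξ,η)`. -/
noncomputable def J (m n : ℕ) (x y ξ η : ℂ) : ℂ :=
  (-1 : ℂ) ^ (n + m + 1) * ∫ s in Set.Ioi (0 : ℝ), Jfun m n x y ξ η s

/-- The nonnegative real axis `[0,∞)` viewed as a subset of `ℂ`. -/
def nonnegRealAxis : Set ℂ := {z : ℂ | ∃ r : ℝ, 0 ≤ r ∧ z = r}

theorem abs_sinh_re_le_norm_sinh (z : ℂ) : |Real.sinh z.re| ≤ ‖Complex.sinh z‖ := by
  have h : Real.sinh z.re = (‖Complex.exp z‖ - ‖Complex.exp (-z)‖) / 2 := by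
    rw [Complex.norm_exp, Complex.norm_exp, Complex.neg_re, Real.sinh_eq]
  rw [h, Complex.sinh, norm_div, abs_div]
  simpa using div_le_div_of_nonneg_right (abs_norm_sub_norm_le (Complex.exp z) (Complex.exp (-z)))
    (zero_le_two (α := ℝ))

theorem norm_inv_tanh_le {z : ℂ} {δ : ℝ} (hδ : 0 < δ) (h : δ ≤ ‖Complex.sinh z‖) :
    ‖(Complex.tanh z)⁻¹‖ ≤ 1 + 1 / δ := by
  have hpos : 0 < ‖Complex.sinh z‖ := hδ.trans_le h
  have hcosh : ‖Complex.cosh z‖ ≤ 1 + ‖Complex.sinh z‖ := by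
    have hsq : ‖Complex.cosh z‖ ^ 2 ≤ ‖Complex.sinh z‖ ^ 2 + 1 := by
      rw [← norm_pow, ← norm_pow, Complex.cosh_sq]
      exact (norm_add_le _ _).trans (by simp)
    exact le_of_sq_le_sq (by nlinarith) (by positivity)
  rw [Complex.tanh_eq_sinh_div_cosh, inv_div, norm_div, div_le_iff₀ hpos]
  have : 1 ≤ 1 / δ * ‖Complex.sinh z‖ := by
    rw [one_div, inv_mul_eq_div, one_le_div hδ]; exact h
  linarith

/-- On the integration ray, the zeros of `tanh` are exactly the excluded points. -/
theorem sinh_ray_ne_zero {x y : ℂ} (hx : x ≠ 0)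
    (hray : ∀ k : ℤ, Complex.I * (y + (k : ℂ) * x) ∉ nonnegRealAxis) {s : ℝ} (hs : 0 ≤ s) :
    Complex.sinh ((π : ℂ) * ((s : ℂ) - Complex.I * y) / x) ≠ 0 := by
  intro h
  have hsin : Complex.sin ((π : ℂ) * ((s : ℂ) - Complex.I * y) / x * Complex.I) = 0 := by
    rw [Complex.sin_mul_I, h, zero_mul]
  obtain ⟨k, hk⟩ := Complex.sin_eq_zero_iff.1 hsin
  refine hray (-k) ⟨s, hs, ?_⟩
  have hπ : (π : ℂ) ≠ 0 := by exact_mod_cast Real.pi_ne_zero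
  rw [div_mul_eq_mul_div, div_eq_iff hx] at hk
  have hk' : ((s : ℂ) - Complex.I * y) * Complex.I = k * x :=
    mul_left_cancel₀ hπ (by linear_combination hk)
  push_cast
  linear_combination Complex.I * hk' - (s - Complex.I * y) * Complex.I_sq

theorem exists_le_norm_sinh_ray {x y : ℂ} (hx : x ≠ 0)
    (hray : ∀ k : ℤ, Complex.I * (y + (k : ℂ) * x) ∉ nonnegRealAxis) :
    ∃ δ : ℝ, 0 < δ ∧ ∀ s : ℝ, 0 ≤ s →
      δ ≤ ‖Complex.sinh ((π : ℂ) * ((s : ℂ) - Complex.I * y) / x)‖ := by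
  set a : ℝ := ((π : ℂ) / x).re with ha
  set b : ℝ := ((π : ℂ) * (Complex.I * y) / x).re with hb
  have hre (s : ℝ) : ((π : ℂ) * ((s : ℂ) - Complex.I * y) / x).re = a * s - b := by
    rw [show (π : ℂ) * ((s : ℂ) - Complex.I * y) / x =
      (π : ℂ) / x * s - (π : ℂ) * (Complex.I * y) / x by ring, Complex.sub_re, Complex.re_mul_ofReal]
  have hlow (s : ℝ) : |a * s - b| ≤ ‖Complex.sinh ((π : ℂ) * ((s : ℂ) - Complex.I * y) / x)‖ := by
    refine le_trans ?_ (abs_sinh_re_le_norm_sinh _)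
    rw [hre, Real.abs_sinh]
    exact Real.self_le_sinh_iff.2 (abs_nonneg _)
  have hcont : Continuous fun s : ℝ ↦
      ‖Complex.sinh ((π : ℂ) * ((s : ℂ) - Complex.I * y) / x)‖ := by
    fun_prop
  rcases eq_or_ne a 0 with h0 | h0
  · refine ⟨|b|, abs_pos.2 fun hb0 ↦ ?_, fun s _ ↦ by simpa [h0] using hlow s⟩
    -- Here `π / x` and `π * I * y / x` are purely imaginary, so a translate of `I * y` is in `[0,∞)`.
    set t : ℝ := ((π : ℂ) / x).im with ht
    set u : ℝ := ((π : ℂ) * (Complex.I * y) / x).im with hu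
    have hx1 : (π : ℂ) / x = t * Complex.I := by
      apply Complex.ext <;> simp [← ha, ← ht, h0]
    have hy1 : (π : ℂ) * (Complex.I * y) / x = u * Complex.I := by
      apply Complex.ext <;> simp only [← hb, ← hu, hb0] <;> simp
    have ht0 : t ≠ 0 := by
      intro h
      rw [h] at hx1
      simp [hx, Real.pi_ne_zero] at hx1
    have htC : (t : ℂ) ≠ 0 := by exact_mod_cast ht0
    have hye : Complex.I * y = ((u / t : ℝ) : ℂ) := by
      have : Complex.I * y * (t * Complex.I) = u * Complex.I := by
        rw [← hx1, ← hy1]; ring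
      push_cast
      rw [eq_div_iff htC]
      exact mul_right_cancel₀ Complex.I_ne_zero (by linear_combination this)
    have hIx : Complex.I * x = ((π / t : ℝ) : ℂ) := by
      rw [div_eq_iff hx] at hx1
      push_cast
      rw [eq_div_iff htC, hx1]
      ring
    have hk : ∃ k : ℤ, 0 ≤ u / t + k * (π / t) := by
      rcases lt_or_gt_of_ne ht0 with hneg | hpos
      · obtain ⟨N, hN⟩ := exists_int_lt (-u / π)
        refine ⟨N, ?_⟩
        rw [lt_div_iff₀ Real.pi_pos] at hN
        rw [show u / t + N * (π / t) = (u + N * π) / t by ring]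
        exact div_nonneg_of_nonpos (by linarith) hneg.le
      · obtain ⟨N, hN⟩ := exists_int_gt (-u / π)
        refine ⟨N, ?_⟩
        rw [div_lt_iff₀ Real.pi_pos] at hN
        rw [show u / t + N * (π / t) = (u + N * π) / t by ring]
        exact div_nonneg (by linarith) hpos.le
    obtain ⟨k, hk⟩ := hk
    refine hray k ⟨_, hk, ?_⟩
    push_cast at hye hIx ⊢
    linear_combination hye + k * hIx
  · set R : ℝ := (1 + |b|) / |a| with hR
    have hapos : 0 < |a| := abs_pos.2 h0
    have hR0 : 0 ≤ R := by positivity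
    obtain ⟨s₀, hs₀, hmin⟩ := isCompact_Icc.exists_isMinOn (Set.nonempty_Icc.2 hR0)
      hcont.continuousOn
    refine ⟨min 1 _, lt_min one_pos
      (norm_pos_iff.2 (sinh_ray_ne_zero hx hray hs₀.1)), fun s hs ↦ ?_⟩
    rcases le_total s R with hsR | hsR
    · exact (min_le_right _ _).trans (hmin ⟨hs, hsR⟩)
    · refine (min_le_left _ _).trans (le_trans ?_ (hlow s))
      have h1 : 1 + |b| ≤ |a * s| := by
        rw [abs_mul, abs_of_nonneg hs]
        rwa [hR, div_le_iff₀' hapos] at hsR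
      have h2 := abs_sub_abs_le_abs_sub (a * s) b
      linarith

theorem norm_pow_div_le (p : ℕ) (w : ℂ) (i j : ℕ) :
    ‖w ^ i / ((j : ℂ) + 1) ^ (p : ℤ)‖ ≤ ‖w‖ ^ i := by
  rw [zpow_natCast, norm_div, norm_pow, norm_pow]
  refine div_le_self (by positivity) (one_le_pow₀ ?_)
  have : ((j : ℂ) + 1) = ((j + 1 : ℕ) : ℂ) := by push_cast; ring
  rw [this, Complex.norm_natCast]
  exact_mod_cast Nat.le_add_left 1 j

theorem summable_geometric_succ {r : ℝ} (h0 : 0 ≤ r) (h1 : r < 1) :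
    Summable fun j : ℕ ↦ r ^ (j + 1) :=
  (summable_nat_add_iff 1).2 (summable_geometric_of_lt_one h0 h1)

theorem norm_Li_le (p : ℕ) {w : ℂ} (hw : ‖w‖ < 1) : ‖Li p w‖ ≤ ‖w‖ / (1 - ‖w‖) := by
  have h : HasSum (fun j : ℕ ↦ ‖w‖ ^ (j + 1)) (‖w‖ / (1 - ‖w‖)) := by
    simpa [pow_succ', div_eq_mul_inv] using
      (hasSum_geometric_of_lt_one (norm_nonneg w) hw).mul_left ‖w‖
  exact tsum_of_norm_bounded h fun j ↦ norm_pow_div_le p w _ _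

theorem continuousOn_Li (p : ℕ) {r : ℝ} (h0 : 0 ≤ r) (h1 : r < 1) :
    ContinuousOn (Li p) (Metric.closedBall 0 r) := by
  refine continuousOn_tsum (u := fun j : ℕ ↦ r ^ (j + 1)) (fun j ↦ by fun_prop)
    (summable_geometric_succ h0 h1) fun j w hw ↦ (norm_pow_div_le p w _ _).trans ?_
  exact pow_le_pow_left₀ (norm_nonneg w) (by simpa using hw) _

theorem hasDerivAt_Li_succ (p : ℕ) {w : ℂ} (hw : ‖w‖ < 1) (hw0 : w ≠ 0) :
    HasDerivAt (Li (p + 1 : ℕ)) (Li p w / w) w := by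
  obtain ⟨r, hwr, hr1⟩ := exists_between hw
  have hr0 : 0 ≤ r := (norm_nonneg w).trans hwr.le
  have hterm : Li p w / w = ∑' j : ℕ, w ^ j / ((j : ℂ) + 1) ^ (p : ℤ) := by
    rw [Li, ← tsum_div_const]
    refine tsum_congr fun j ↦ ?_
    rw [pow_succ]
    field_simp
  rw [hterm]
  refine hasDerivAt_tsum_of_isPreconnected (t := Metric.ball 0 r) (y₀ := w)
    (g := fun (j : ℕ) (z : ℂ) ↦ z ^ (j + 1) / ((j : ℂ) + 1) ^ ((p + 1 : ℕ) : ℤ))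
    (g' := fun (j : ℕ) (z : ℂ) ↦ z ^ j / ((j : ℂ) + 1) ^ (p : ℤ))
    (summable_geometric_of_lt_one hr0 hr1) Metric.isOpen_ball
    (convex_ball _ _).isPreconnected (fun j z _ ↦ ?_) (fun j z hz ↦ ?_) (by simpa using hwr)
    ?_ (by simpa using hwr)
  · have hj : (j : ℂ) + 1 ≠ 0 := Nat.cast_add_one_ne_zero j
    refine ((hasDerivAt_pow (j + 1) z).div_const _).congr_deriv ?_
    rw [zpow_natCast, zpow_natCast, pow_succ]
    push_cast
    field_simp
  · exact (norm_pow_div_le p z _ _).trans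
      (pow_le_pow_left₀ (norm_nonneg z) (mem_ball_zero_iff.1 hz).le _)
  · exact Summable.of_norm_bounded (summable_geometric_succ (norm_nonneg w) hw)
      fun j ↦ norm_pow_div_le _ w _ _

theorem norm_exp_argument (x y ξ η : ℂ) (s : ℝ) :
    ‖Complex.exp (-(2 * (π : ℂ)) * (1 - ξ / x) * s +
        2 * (π : ℂ) * Complex.I * (η - ξ * y / x))‖ =
      Real.exp (-(2 * π * (1 - (ξ / x).re)) * s) * Real.exp (-(2 * π * (η - ξ * y / x).im)) := by
  rw [Complex.norm_exp, ← Real.exp_add]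
  congr 1
  have h1 : -(2 * (π : ℂ)) * (1 - ξ / x) * s = ((-(2 * π * s) : ℝ) : ℂ) * (1 - ξ / x) := by
    push_cast; ring
  have h2 : 2 * (π : ℂ) * Complex.I * (η - ξ * y / x) =
      ((2 * π : ℝ) : ℂ) * (Complex.I * (η - ξ * y / x)) := by
    push_cast; ring
  rw [h1, h2, Complex.add_re, Complex.re_ofReal_mul, Complex.re_ofReal_mul, Complex.I_mul_re,
    Complex.sub_re, Complex.one_re]
  ring

theorem norm_exp_argument_le {x y ξ η : ℂ} {c d : ℝ} (hc : (ξ / x).re ≤ 1 - c)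
    (hd : d ≤ (η - ξ * y / x).im) {s : ℝ} (hs : 0 ≤ s) :
    ‖Complex.exp (-(2 * (π : ℂ)) * (1 - ξ / x) * s +
        2 * (π : ℂ) * Complex.I * (η - ξ * y / x))‖ ≤
      Real.exp (-(2 * π * c) * s) * Real.exp (-(2 * π * d)) := by
  rw [norm_exp_argument]
  have hπ := Real.pi_pos
  gcongr
  linarith

theorem norm_exp_argument_le_of_pos {x y ξ η : ℂ} {c d : ℝ} (hc0 : 0 < c)
    (hc : (ξ / x).re ≤ 1 - c) (hd : d ≤ (η - ξ * y / x).im) {s : ℝ} (hs : 0 ≤ s) :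
    ‖Complex.exp (-(2 * (π : ℂ)) * (1 - ξ / x) * s +
        2 * (π : ℂ) * Complex.I * (η - ξ * y / x))‖ ≤ Real.exp (-(2 * π * d)) := by
  refine (norm_exp_argument_le hc hd hs).trans (mul_le_of_le_one_left (Real.exp_nonneg _) ?_)
  rw [Real.exp_le_one_iff, neg_mul, neg_nonpos]
  positivity

theorem exp_neg_two_pi_mul_lt_one {d : ℝ} (hd0 : 0 < d) : Real.exp (-(2 * π * d)) < 1 := by
  rw [Real.exp_lt_one_iff, neg_lt_zero]
  positivity

theorem norm_Jfun_le (p n : ℕ) {x y ξ η : ℂ} {c d K : ℝ} (hc0 : 0 < c) (hd0 : 0 < d)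
    (hc : (ξ / x).re ≤ 1 - c) (hd : d ≤ (η - ξ * y / x).im) {s : ℝ} (hs : 0 ≤ s)
    (hK : ‖(Complex.tanh ((π : ℂ) * ((s : ℂ) - Complex.I * y) / x))⁻¹‖ ≤ K) :
    ‖Jfun p n x y ξ η s‖ ≤
      K / (1 - Real.exp (-(2 * π * d))) * (s ^ n * Real.exp (-(2 * π * c) * s)) := by
  have hr := exp_neg_two_pi_mul_lt_one hd0
  have h1 := norm_exp_argument_le hc hd hs
  have h2 := norm_exp_argument_le_of_pos hc0 hc hd hs
  have h3 := norm_Li_le p (h2.trans_lt hr)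
  set w := Complex.exp (-(2 * (π : ℂ)) * (1 - ξ / x) * s +
        2 * (π : ℂ) * Complex.I * (η - ξ * y / x)) with hw
  have h4 : ‖w‖ ≤ Real.exp (-(2 * π * c) * s) :=
    h1.trans (mul_le_of_le_one_right (Real.exp_nonneg _) hr.le)
  have h5 : ‖Li p w‖ ≤ Real.exp (-(2 * π * c) * s) / (1 - Real.exp (-(2 * π * d))) :=
    h3.trans (div_le_div₀ (Real.exp_nonneg _) h4 (by linarith) (by linarith))
  rw [Jfun, ← hw, div_eq_mul_inv, norm_mul, norm_mul, norm_pow, Complex.norm_real,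
    Real.norm_of_nonneg hs]
  calc s ^ n * ‖Li p w‖ * _ ≤
      s ^ n * (Real.exp (-(2 * π * c) * s) / (1 - Real.exp (-(2 * π * d)))) * K := by
        have : 0 < 1 - Real.exp (-(2 * π * d)) := by linarith
        gcongr
    _ = _ := by ring

theorem continuousOn_Jfun (p n : ℕ) {x y ξ η : ℂ} (hx : x ≠ 0)
    (hξ : (ξ / x).re < 1) (hη : 0 < (η - ξ * y / x).im)
    (hray : ∀ k : ℤ, Complex.I * (y + (k : ℂ) * x) ∉ nonnegRealAxis) :
    ContinuousOn (Jfun p n x y ξ η) (Set.Ici 0) := by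
  have hLi : ContinuousOn (fun s : ℝ ↦ Li p (Complex.exp (-(2 * (π : ℂ)) * (1 - ξ / x) * s +
        2 * (π : ℂ) * Complex.I * (η - ξ * y / x)))) (Set.Ici 0) := by
    refine (continuousOn_Li p (Real.exp_nonneg _) (exp_neg_two_pi_mul_lt_one hη)).comp
      (by fun_prop) fun s hs ↦ ?_
    rw [mem_closedBall_zero_iff]
    exact norm_exp_argument_le_of_pos (sub_pos.2 hξ) (by simp) le_rfl hs
  have hcoth : ContinuousOn
      (fun s : ℝ ↦ Complex.cosh ((π : ℂ) * ((s : ℂ) - Complex.I * y) / x) /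
        Complex.sinh ((π : ℂ) * ((s : ℂ) - Complex.I * y) / x)) (Set.Ici 0) :=
    ContinuousOn.div (by fun_prop) (by fun_prop) fun s hs ↦ sinh_ray_ne_zero hx hray hs
  refine (((by fun_prop : Continuous fun s : ℝ ↦ (s : ℂ) ^ n).continuousOn.mul hLi).mul
    hcoth).congr fun s _ ↦ ?_
  rw [Jfun, div_eq_mul_inv, Complex.tanh_eq_sinh_div_cosh, inv_div]
  rfl

theorem integrableOn_pow_mul_exp_neg_mul (n : ℕ) {b : ℝ} (hb : 0 < b) :
    IntegrableOn (fun s : ℝ ↦ s ^ n * Real.exp (-b * s)) (Set.Ioi 0) := by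
  simpa using integrableOn_rpow_mul_exp_neg_mul_rpow (s := n) (p := 1)
    (by have : (0 : ℝ) ≤ n := n.cast_nonneg
        linarith) one_pos hb

theorem integrableOn_Jfun (p n : ℕ) {x y ξ η : ℂ} (hx : x ≠ 0)
    (hξ : (ξ / x).re < 1) (hη : 0 < (η - ξ * y / x).im)
    (hray : ∀ k : ℤ, Complex.I * (y + (k : ℂ) * x) ∉ nonnegRealAxis) :
    IntegrableOn (Jfun p n x y ξ η) (Set.Ioi 0) := by
  obtain ⟨δ, hδ, hle⟩ := exists_le_norm_sinh_ray hx hray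
  have hc : 0 < 1 - (ξ / x).re := sub_pos.2 hξ
  refine Integrable.mono' ((integrableOn_pow_mul_exp_neg_mul n
      (by positivity : 0 < 2 * π * (1 - (ξ / x).re))).const_mul
        ((1 + 1 / δ) / (1 - Real.exp (-(2 * π * (η - ξ * y / x).im)))))
    (((continuousOn_Jfun p n hx hξ hη hray).mono Set.Ioi_subset_Ici_self).aestronglyMeasurable
      measurableSet_Ioi)
    ((ae_restrict_mem measurableSet_Ioi).mono fun s hs ↦ ?_)
  exact norm_Jfun_le p n hc hη (by simp) le_rfl (le_of_lt hs)
    (norm_inv_tanh_le hδ (hle s (le_of_lt hs)))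

theorem hasDerivAt_Jfun (p n : ℕ) {x y ξ η : ℂ} (hξ : (ξ / x).re < 1)
    (hη : 0 < (η - ξ * y / x).im) {s : ℝ} (hs : 0 ≤ s) :
    HasDerivAt (fun ξ' ↦ Jfun (p + 1) n x y ξ' η s)
      (2 * (π : ℂ) / x * Jfun p (n + 1) x y ξ η s -
        2 * (π : ℂ) * Complex.I * y / x * Jfun p n x y ξ η s) ξ := by
  have harg : HasDerivAt (fun ξ' : ℂ ↦ -(2 * (π : ℂ)) * (1 - ξ' / x) * s +
        2 * (π : ℂ) * Complex.I * (η - ξ' * y / x))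
      (-(2 * (π : ℂ)) * (-(1 / x)) * s + 2 * (π : ℂ) * Complex.I * (-(1 * y / x))) ξ :=
    ((((hasDerivAt_id ξ).div_const x).const_sub 1).const_mul _ |>.mul_const _).add
      (((((hasDerivAt_id ξ).mul_const y).div_const x).const_sub η).const_mul _)
  have hw := (norm_exp_argument_le_of_pos (sub_pos.2 hξ) (by simp) le_rfl hs).trans_lt
    (exp_neg_two_pi_mul_lt_one hη)
  have hLi := (hasDerivAt_Li_succ p hw (Complex.exp_ne_zero _)).comp ξ harg.cexp
  refine ((hLi.const_mul ((s : ℂ) ^ n)).div_const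
    (Complex.tanh ((π : ℂ) * ((s : ℂ) - Complex.I * y) / x))).congr_deriv ?_
  simp only [Jfun]
  rw [← mul_assoc (Li _ _ / _), div_mul_cancel₀ _ (Complex.exp_ne_zero _)]
  ring

theorem stmt3 (m n : ℕ) (hm : 1 ≤ m) (x y ξ η : ℂ) (hx : x ≠ 0)
    (hξ : (ξ / x).re < 1) (hη : 0 < (η - ξ * y / x).im)
    (hray : ∀ k : ℤ, Complex.I * (y + (k : ℂ) * x) ∉ nonnegRealAxis) :
    HasDerivAt (fun ξ' : ℂ => J m n x y ξ' η)
      (2 * (π : ℂ) / x * J (m - 1) (n + 1) x y ξ η +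
        2 * (π : ℂ) * Complex.I * y / x * J (m - 1) n x y ξ η) ξ := by
  obtain ⟨p, rfl⟩ := Nat.exists_eq_add_of_le' hm
  obtain ⟨δ, hδ, hle⟩ := exists_le_norm_sinh_ray hx hray
  set c : ℝ := (1 - (ξ / x).re) / 2 with hc
  set d : ℝ := (η - ξ * y / x).im / 2 with hd
  have hc0 : 0 < c := by linarith
  have hd0 : 0 < d := by linarith
  set U : Set ℂ := {z | (z / x).re < 1 - c ∧ d < (η - z * y / x).im} with hU
  have hUopen : IsOpen U := by
    have hre : Continuous fun z : ℂ ↦ (z / x).re := by fun_prop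
    have him : Continuous fun z : ℂ ↦ (η - z * y / x).im := by fun_prop
    exact (isOpen_lt hre continuous_const).inter (isOpen_lt continuous_const him)
  have hUnhds : U ∈ nhds ξ := hUopen.mem_nhds ⟨by linarith, by linarith⟩
  have hI1 := integrableOn_Jfun p (n + 1) hx hξ hη hray
  have hI0 := integrableOn_Jfun p n hx hξ hη hray
  have hexp (k : ℕ) := (integrableOn_pow_mul_exp_neg_mul k
    (by positivity : 0 < 2 * π * c)).const_mul
      ((1 + 1 / δ) / (1 - Real.exp (-(2 * π * d))))
  have hmain := hasDerivAt_integral_of_dominated_loc_of_deriv_le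
    (μ := volume.restrict (Set.Ioi (0 : ℝ)))
    (F := fun ξ' s ↦ Jfun (p + 1) n x y ξ' η s)
    (F' := fun ξ' s ↦ 2 * (π : ℂ) / x * Jfun p (n + 1) x y ξ' η s -
        2 * (π : ℂ) * Complex.I * y / x * Jfun p n x y ξ' η s)
    hUnhds
    (Filter.mem_of_superset hUnhds fun z hz ↦
      (integrableOn_Jfun (p + 1) n hx (by linarith [hz.1]) (hd0.trans hz.2)
        hray).aestronglyMeasurable)
    (integrableOn_Jfun (p + 1) n hx hξ hη hray)
    ((hI1.const_mul _).sub (hI0.const_mul _)).aestronglyMeasurable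
    ((ae_restrict_mem measurableSet_Ioi).mono fun s hs z hz ↦ by
      have hK := norm_inv_tanh_le hδ (hle s (le_of_lt hs))
      refine (norm_sub_le _ _).trans ?_
      rw [norm_mul, norm_mul]
      exact add_le_add
        (mul_le_mul_of_nonneg_left
          (norm_Jfun_le p (n + 1) hc0 hd0 hz.1.le hz.2.le (le_of_lt hs) hK) (norm_nonneg _))
        (mul_le_mul_of_nonneg_left
          (norm_Jfun_le p n hc0 hd0 hz.1.le hz.2.le (le_of_lt hs) hK) (norm_nonneg _)))
    (((hexp (n + 1)).const_mul _).add ((hexp n).const_mul _))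
    ((ae_restrict_mem measurableSet_Ioi).mono fun s hs z hz ↦
      hasDerivAt_Jfun p n (by linarith [hz.1]) (hd0.trans hz.2) (le_of_lt hs))
  refine (hmain.2.const_mul ((-1 : ℂ) ^ (n + (p + 1) + 1))).congr_deriv ?_
  rw [integral_sub (hI1.const_mul _) (hI0.const_mul _), integral_const_mul, integral_const_mul,
    Nat.add_sub_cancel, J, J]
  ring
end

section
/- Let m ≥ 1, n ≥ 0 be integers with m + n ≥ 2, and let x, ξ ∈ ℂ with Re x ≠ 0 and Re(ξ/x) < 1. Then the function t ↦ J̃_{m,n}(x + t, ξ + t) (for complex t near 0) is complex-differentiable at t = 0, with derivative (∂_x + ∂_ξ) J̃_{m,n}(x,ξ) = ((n+1)/x) · J̃_{m,n}(x,ξ) + (−1)^{m+n+1} · n! · ζ(m+n) / (π (2π)^n), where ζ is the Riemann zeta function. -/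
open MeasureTheory Real Filter

/-- The integrand in the definition of `J̃_{m,n}(x,ξ)`. -/
noncomputable def Jtfun (m n : ℕ) (x ξ : ℂ) (s : ℝ) : ℂ :=
  (s : ℂ) ^ n *
    (Li m (Complex.exp (-(2 * (π : ℂ)) * (1 - ξ / x) * s)) / Complex.tanh ((π : ℂ) * s / x) -
      x / ((π : ℂ) * s) * Li m (Complex.exp (-(2 * (π : ℂ)) * s)))

/-- The function `J̃_{m,n}(x,ξ)`. -/
noncomputable def Jt (m n : ℕ) (x ξ : ℂ) : ℂ :=
  (-1 : ℂ) ^ (n + m + 1) * ∫ s in Set.Ioi (0 : ℝ), Jtfun m n x ξ s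

open Set Topology

theorem Complex.abs_sinh_re_le_norm_sinh (w : ℂ) : |Real.sinh w.re| ≤ ‖Complex.sinh w‖ := by
  have h := abs_norm_sub_norm_le (Complex.exp w) (Complex.exp (-w))
  rw [Complex.norm_exp, Complex.norm_exp, Complex.neg_re] at h
  rw [Complex.sinh, Real.sinh_eq, norm_div, abs_div]
  simpa using div_le_div_of_nonneg_right h (by norm_num : (0 : ℝ) ≤ 2)

theorem Complex.norm_cosh_le (w : ℂ) : ‖Complex.cosh w‖ ≤ Real.cosh w.re := by
  have h := norm_add_le (Complex.exp w) (Complex.exp (-w))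
  rw [Complex.norm_exp, Complex.norm_exp, Complex.neg_re] at h
  rw [Complex.cosh, Real.cosh_eq, norm_div]
  simpa using div_le_div_of_nonneg_right h (by norm_num : (0 : ℝ) ≤ 2)

theorem Real.abs_le_abs_sinh (a : ℝ) : |a| ≤ |Real.sinh a| := by
  rw [Real.abs_sinh]
  exact Real.self_le_sinh_iff.2 (abs_nonneg a)

theorem Real.cosh_le_abs_sinh_add_one (a : ℝ) : Real.cosh a ≤ |Real.sinh a| + 1 := by
  rw [Real.abs_sinh, ← Real.cosh_abs, ← sub_le_iff_le_add', Real.cosh_sub_sinh]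
  exact Real.exp_le_one_iff.2 (by simp)

theorem Complex.sinh_ne_zero_of_re_ne_zero {w : ℂ} (hw : w.re ≠ 0) : Complex.sinh w ≠ 0 := by
  rw [← norm_pos_iff]
  exact (abs_pos.2 hw).trans_le ((Real.abs_le_abs_sinh _).trans (Complex.abs_sinh_re_le_norm_sinh w))

theorem Complex.cosh_ne_zero_of_re_ne_zero {w : ℂ} (hw : w.re ≠ 0) : Complex.cosh w ≠ 0 := by
  intro h
  have h2 : Complex.sinh (2 * w) = 0 := by rw [Complex.sinh_two_mul, h, mul_zero]
  exact Complex.sinh_ne_zero_of_re_ne_zero (by simpa using hw) h2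

theorem Complex.norm_mul_cosh_sub_sinh_le {w : ℂ} (hw : ‖w‖ ≤ 1) :
    ‖w * Complex.cosh w - Complex.sinh w‖ ≤ 2 * ‖w‖ ^ 2 := by
  have h1 := Complex.norm_exp_sub_one_sub_id_le hw
  have h2 := Complex.norm_exp_sub_one_sub_id_le (x := -w) (by simpa using hw)
  rw [norm_neg] at h2
  have key : w * Complex.cosh w - Complex.sinh w
      = w * ((Complex.exp w - 1 - w) / 2 + (Complex.exp (-w) - 1 - -w) / 2)
        - ((Complex.exp w - 1 - w) / 2 - (Complex.exp (-w) - 1 - -w) / 2) := by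
    rw [Complex.cosh, Complex.sinh]
    ring
  have h1' : ‖(Complex.exp w - 1 - w) / 2‖ ≤ ‖w‖ ^ 2 / 2 := by
    rw [norm_div]; simpa using div_le_div_of_nonneg_right h1 (by norm_num : (0 : ℝ) ≤ 2)
  have h2' : ‖(Complex.exp (-w) - 1 - -w) / 2‖ ≤ ‖w‖ ^ 2 / 2 := by
    rw [norm_div]; simpa using div_le_div_of_nonneg_right h2 (by norm_num : (0 : ℝ) ≤ 2)
  rw [key]
  refine (norm_sub_le _ _).trans ?_
  rw [norm_mul]
  have h3 := (norm_add_le ((Complex.exp w - 1 - w) / 2) ((Complex.exp (-w) - 1 - -w) / 2))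
  have h4 := (norm_sub_le ((Complex.exp w - 1 - w) / 2) ((Complex.exp (-w) - 1 - -w) / 2))
  have h5 : ‖w‖ * ‖(Complex.exp w - 1 - w) / 2 + (Complex.exp (-w) - 1 - -w) / 2‖
      ≤ 1 * ‖w‖ ^ 2 :=
    mul_le_mul hw (by linarith) (norm_nonneg _) zero_le_one
  linarith

/-- In a sector around the real axis, `coth w - 1 / w` is bounded. -/
theorem Complex.norm_inv_tanh_sub_inv_le {K : ℝ} {w : ℂ} (hw : w.re ≠ 0)
    (hK : ‖w‖ ≤ K * |w.re|) : ‖1 / Complex.tanh w - 1 / w‖ ≤ 2 * K + 2 := by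
  have hw0 : w ≠ 0 := by rintro rfl; simp at hw
  have hwpos : 0 < ‖w‖ := norm_pos_iff.2 hw0
  have ha : 0 < |w.re| := abs_pos.2 hw
  have hKpos : 0 < K := by
    by_contra h
    nlinarith [not_lt.1 h]
  have hs := Complex.abs_sinh_re_le_norm_sinh w
  have hs0 := Complex.sinh_ne_zero_of_re_ne_zero hw
  have hsa : |w.re| ≤ ‖Complex.sinh w‖ := (Real.abs_le_abs_sinh _).trans hs
  have hspos : 0 < ‖Complex.sinh w‖ := norm_pos_iff.2 hs0
  rw [Complex.tanh_eq_sinh_div_cosh, one_div_div]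
  rcases le_total ‖w‖ 1 with h1 | h1
  · have h2 : Complex.cosh w / Complex.sinh w - 1 / w
        = (w * Complex.cosh w - Complex.sinh w) / (w * Complex.sinh w) := by
      field_simp
    rw [h2, norm_div, norm_mul, div_le_iff₀ (by positivity)]
    have h3 := Complex.norm_mul_cosh_sub_sinh_le h1
    have h4 : ‖w‖ ≤ K * ‖Complex.sinh w‖ := hK.trans (by gcongr)
    nlinarith [mul_le_mul_of_nonneg_left h4 hwpos.le, mul_pos hwpos hspos]
  · refine (norm_sub_le _ _).trans ?_
    have h2 : ‖(1 : ℂ) / w‖ ≤ 1 := by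
      rw [norm_div, norm_one]; exact (div_le_one hwpos).2 h1
    have h3 : ‖Complex.cosh w / Complex.sinh w‖ ≤ 1 + K := by
      rw [norm_div, div_le_iff₀ hspos]
      have h4 := Complex.norm_cosh_le w
      have h5 := Real.cosh_le_abs_sinh_add_one w.re
      have h6 : 1 ≤ K * ‖Complex.sinh w‖ := h1.trans (hK.trans (by gcongr))
      linarith
    linarith

/-- The function `a ↦ Li_p(e^{-a})`. -/
noncomputable def LiExp (p : ℕ) (a : ℂ) : ℂ := Li p (Complex.exp (-a))

theorem LiExp_eq_tsum (p : ℕ) :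
    LiExp p = fun a => ∑' j : ℕ, Complex.exp (-(((j : ℂ) + 1) * a)) / ((j : ℂ) + 1) ^ p := by
  ext a
  simp only [LiExp, Li, zpow_natCast, ← Complex.exp_nat_mul]
  refine tsum_congr fun j => ?_
  push_cast
  ring_nf

theorem norm_LiExp_term (p j : ℕ) (a : ℂ) :
    ‖Complex.exp (-(((j : ℂ) + 1) * a)) / ((j : ℂ) + 1) ^ p‖
      = Real.exp (-(((j : ℝ) + 1) * a.re)) / ((j : ℝ) + 1) ^ p := by
  have h : ‖(j : ℂ) + 1‖ = (j : ℝ) + 1 := by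
    rw [← Nat.cast_succ, Complex.norm_natCast, Nat.cast_succ]
  have h' : (-(((j : ℂ) + 1) * a)).re = -(((j : ℝ) + 1) * a.re) := by
    simp
  rw [norm_div, norm_pow, h, Complex.norm_exp, h']

theorem summable_exp_neg_succ_mul {t : ℝ} (ht : 0 < t) :
    Summable fun j : ℕ => Real.exp (-(((j : ℝ) + 1) * t)) := by
  have h := (summable_nat_add_iff 1).2
    (summable_geometric_of_lt_one (Real.exp_pos (-t)).le (by simpa using ht))
  refine h.congr fun j => ?_
  rw [← Real.exp_nat_mul]
  push_cast
  ring_nf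

theorem norm_LiExp_term_le {t : ℝ} (p j : ℕ) {a : ℂ} (ha : t ≤ a.re) :
    ‖Complex.exp (-(((j : ℂ) + 1) * a)) / ((j : ℂ) + 1) ^ p‖
      ≤ Real.exp (-(((j : ℝ) + 1) * t)) := by
  rw [norm_LiExp_term]
  refine (div_le_self (Real.exp_pos _).le
    (one_le_pow₀ (by linarith [j.cast_nonneg (α := ℝ)]))).trans ?_
  gcongr

theorem hasSum_LiExp (p : ℕ) {a : ℂ} (ha : 0 < a.re) :
    HasSum (fun j : ℕ => Complex.exp (-(((j : ℂ) + 1) * a)) / ((j : ℂ) + 1) ^ p) (LiExp p a) := by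
  rw [LiExp_eq_tsum]
  exact (Summable.of_norm_bounded (summable_exp_neg_succ_mul ha)
    fun j => norm_LiExp_term_le p j le_rfl).hasSum

theorem hasDerivAt_LiExp (p : ℕ) {a : ℂ} (ha : 0 < a.re) :
    HasDerivAt (LiExp (p + 1)) (-LiExp p a) a := by
  have hU : IsOpen {b : ℂ | a.re / 2 < b.re} := isOpen_lt continuous_const Complex.continuous_re
  have haU : a ∈ {b : ℂ | a.re / 2 < b.re} := by simpa using ha
  have hterm : ∀ (j : ℕ) (b : ℂ), HasDerivAt
      (fun b : ℂ => Complex.exp (-(((j : ℂ) + 1) * b)) / ((j : ℂ) + 1) ^ (p + 1))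
      (-(Complex.exp (-(((j : ℂ) + 1) * b)) / ((j : ℂ) + 1) ^ p)) b := by
    intro j b
    have hj : (j : ℂ) + 1 ≠ 0 := Nat.cast_add_one_ne_zero j
    convert! ((((hasDerivAt_id b).const_mul ((j : ℂ) + 1)).neg).cexp).div_const
      (((j : ℂ) + 1) ^ (p + 1)) using 1
    simp
    field_simp
    ring
  have hsum := summable_exp_neg_succ_mul (half_pos ha)
  have hle : ∀ (j : ℕ) (b : ℂ), b ∈ {b : ℂ | a.re / 2 < b.re} →
      ‖Complex.exp (-(((j : ℂ) + 1) * b)) / ((j : ℂ) + 1) ^ (p + 1)‖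
        ≤ Real.exp (-(((j : ℝ) + 1) * (a.re / 2))) :=
    fun j b hb => norm_LiExp_term_le (p + 1) j (le_of_lt hb)
  have hdiff : ∀ j : ℕ, DifferentiableOn ℂ
      (fun b : ℂ => Complex.exp (-(((j : ℂ) + 1) * b)) / ((j : ℂ) + 1) ^ (p + 1))
      {b : ℂ | a.re / 2 < b.re} :=
    fun j b _ => (hterm j b).differentiableAt.differentiableWithinAt
  have h1 := Complex.hasSum_deriv_of_summable_norm hsum hdiff hU hle haU
  have h2 := Complex.differentiableOn_tsum_of_summable_norm hsum hdiff hU hle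
  have h3 := (h2.differentiableAt (hU.mem_nhds haU)).hasDerivAt
  rw [← LiExp_eq_tsum] at h1 h3
  simp only [fun j : ℕ => (hterm j a).deriv] at h1
  rwa [h1.unique (hasSum_LiExp p ha).neg] at h3

theorem exists_norm_LiExp_succ_le : ∃ C : ℝ, ∀ (p : ℕ) (t : ℝ), 0 < t → ∀ a : ℂ,
    t ≤ a.re → ‖LiExp (p + 1) a‖ ≤ C * (t ^ (-(1 / 2) : ℝ) * Real.exp (-(t / 2))) := by
  have hS : Summable fun j : ℕ => ((j : ℝ) + 1) ^ (-(3 / 2) : ℝ) := by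
    have := (summable_nat_add_iff 1).2
      (Real.summable_nat_rpow.2 (by norm_num : (-(3 / 2) : ℝ) < -1))
    simpa using this
  have hexp : ∀ u : ℝ, 0 < u → Real.exp (-u) ≤ u ^ (-(1 / 2) : ℝ) := by
    intro u hu
    rw [Real.rpow_def_of_pos hu]
    refine Real.exp_le_exp.2 ?_
    linarith [Real.log_le_sub_one_of_pos hu]
  refine ⟨(1 / 2 : ℝ) ^ (-(1 / 2) : ℝ) * ∑' j : ℕ, ((j : ℝ) + 1) ^ (-(3 / 2) : ℝ),
    fun p t ht a ha => ?_⟩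
  have ha' : 0 < a.re := ht.trans_le ha
  rw [← (hasSum_LiExp (p + 1) ha').tsum_eq]
  refine tsum_of_norm_bounded (g := fun j : ℕ => (1 / 2 : ℝ) ^ (-(1 / 2) : ℝ) *
    ((j : ℝ) + 1) ^ (-(3 / 2) : ℝ) * (t ^ (-(1 / 2) : ℝ) * Real.exp (-(t / 2))))
    ((hS.hasSum.mul_left _).mul_right _) fun j => ?_
  have hj : (0 : ℝ) < (j : ℝ) + 1 := by positivity
  have hj1 : (1 : ℝ) ≤ (j : ℝ) + 1 := by linarith [j.cast_nonneg (α := ℝ)]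
  rw [norm_LiExp_term]
  have h1 : Real.exp (-(((j : ℝ) + 1) * a.re))
      ≤ (1 / 2 * (((j : ℝ) + 1) * t)) ^ (-(1 / 2) : ℝ) * Real.exp (-(t / 2)) := by
    calc Real.exp (-(((j : ℝ) + 1) * a.re)) ≤ Real.exp (-(((j : ℝ) + 1) * t)) := by gcongr
      _ = Real.exp (-(1 / 2 * (((j : ℝ) + 1) * t))) * Real.exp (-(((j : ℝ) + 1) * t / 2)) := by
        rw [← Real.exp_add]; ring_nf
      _ ≤ _ := by
        gcongr
        · exact hexp _ (by positivity)
        · nlinarith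
  have h2 : ((j : ℝ) + 1) ^ (-(3 / 2) : ℝ) = ((j : ℝ) + 1) ^ (-(1 / 2) : ℝ) / ((j : ℝ) + 1) := by
    rw [← Real.rpow_sub_one hj.ne']; norm_num
  rw [Real.mul_rpow (by norm_num) (by positivity), Real.mul_rpow hj.le ht.le] at h1
  calc _ ≤ Real.exp (-(((j : ℝ) + 1) * a.re)) / ((j : ℝ) + 1) := by
        gcongr
        exact le_self_pow₀ hj1 (by simp)
    _ ≤ _ := div_le_div_of_nonneg_right h1 hj.le
    _ = _ := by rw [h2]; ring

theorem norm_LiExp_sub_le {C t : ℝ} {p : ℕ} (ht : 0 < t)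
    (hC : ∀ a : ℂ, t ≤ a.re → ‖LiExp p a‖ ≤ C) {a b : ℂ} (ha : t ≤ a.re) (hb : t ≤ b.re) :
    ‖LiExp (p + 1) a - LiExp (p + 1) b‖ ≤ C * ‖a - b‖ :=
  Convex.norm_image_sub_le_of_norm_hasDerivWithin_le (s := {z : ℂ | t ≤ z.re})
    (fun _ hz => (hasDerivAt_LiExp p (ht.trans_le hz)).hasDerivWithinAt)
    (fun z hz => by simpa using hC z hz)
    (convex_halfSpace_re_ge t) hb ha

theorem integral_pow_mul_LiExp (p n : ℕ) (hpn : 1 ≤ p + n) :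
    ∫ s in Ioi (0 : ℝ), (s : ℂ) ^ n * LiExp p (2 * (π : ℂ) * s)
      = (Nat.factorial n : ℂ) * riemannZeta ((p + 1 + n : ℕ) : ℂ) / (2 * (π : ℂ)) ^ (n + 1) := by
  have hF : ∀ t ∈ Ioi (0 : ℝ), HasSum (fun j : ℕ => (1 / ((j : ℂ) + 1) ^ p) *
      Real.exp (-(2 * π * ((j : ℝ) + 1)) * t)) (LiExp p (2 * (π : ℂ) * t)) := by
    intro t ht
    have h := hasSum_LiExp p (a := 2 * (π : ℂ) * t) (by
      have : (0 : ℝ) < t := ht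
      simp; positivity)
    refine h.congr_fun fun j => ?_
    push_cast
    ring_nf
  have hzeta : Summable fun j : ℕ => 1 / ((j : ℝ) + 1) ^ (p + 1 + n) := by
    have := (summable_nat_add_iff 1).2
      (Real.summable_one_div_nat_pow.2 (by lia : 1 < p + 1 + n))
    simpa using this
  have hnorm : ∀ j : ℕ, ‖(j : ℂ) + 1‖ = (j : ℝ) + 1 := fun j => by
    rw [← Nat.cast_succ, Complex.norm_natCast, Nat.cast_succ]
  have h := hasSum_mellin (s := ((n : ℂ) + 1)) (p := fun j : ℕ => 2 * π * ((j : ℝ) + 1))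
    (fun j => Or.inr (by positivity)) (by simp; positivity) hF (by
      refine (hzeta.mul_left (1 / (2 * π) ^ (n + 1))).congr fun j => ?_
      have : ((n : ℂ) + 1).re = ((n + 1 : ℕ) : ℝ) := by simp
      rw [this, Real.rpow_natCast, norm_div, norm_pow, hnorm, norm_one,
        mul_pow (2 * π) ((j : ℝ) + 1)]
      field_simp
      ring)
  have hm : mellin (fun t : ℝ => LiExp p (2 * (π : ℂ) * t)) ((n : ℂ) + 1)
      = ∫ s in Ioi (0 : ℝ), (s : ℂ) ^ n * LiExp p (2 * (π : ℂ) * s) := by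
    simp [mellin]
  rw [← hm, ← h.tsum_eq, zeta_eq_tsum_one_div_nat_add_one_cpow (by
    simp; norm_cast; lia), mul_div_assoc, ← tsum_div_const, ← tsum_mul_left]
  refine tsum_congr fun j => ?_
  have hj : (j : ℂ) + 1 ≠ 0 := Nat.cast_add_one_ne_zero j
  rw [Complex.Gamma_nat_eq_factorial, Complex.cpow_natCast]
  have : ((n : ℂ) + 1) = ((n + 1 : ℕ) : ℂ) := by simp
  rw [this, Complex.cpow_natCast]
  push_cast
  rw [mul_pow]
  field_simp
  ring

theorem integrableOn_pow_mul_LiExp (p n : ℕ) (hpn : 1 ≤ p + n) :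
    IntegrableOn (fun s : ℝ => (s : ℂ) ^ n * LiExp p (2 * (π : ℂ) * s)) (Ioi 0) := by
  refine Integrable.of_integral_ne_zero ?_
  rw [integral_pow_mul_LiExp p n hpn]
  have hz : riemannZeta ((p + 1 + n : ℕ) : ℂ) ≠ 0 :=
    riemannZeta_ne_zero_of_one_le_re (by rw [Complex.natCast_re]; exact_mod_cast by lia)
  have hπ : (π : ℂ) ≠ 0 := by exact_mod_cast Real.pi_ne_zero
  have hn : (Nat.factorial n : ℂ) ≠ 0 := by exact_mod_cast Nat.factorial_ne_zero n
  exact div_ne_zero (mul_ne_zero hn hz) (pow_ne_zero _ (mul_ne_zero two_ne_zero hπ))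

/-- Differentiation under the integral sign for a holomorphic family of functions
with an integrable bound that is locally uniform in the parameter. -/
theorem Complex.hasDerivAt_integral_of_norm_le {α : Type*} [MeasurableSpace α] {μ : Measure α}
    {F : ℂ → α → ℂ} {bound : α → ℝ} {x : ℂ} {r : ℝ} (hr : 0 < r)
    (hmeas : ∀ y ∈ Metric.ball x r, AEStronglyMeasurable (F y) μ)
    (hdiff : ∀ᵐ s ∂μ, DifferentiableOn ℂ (fun y => F y s) (Metric.ball x r))
    (hbound : ∀ᵐ s ∂μ, ∀ y ∈ Metric.ball x r, ‖F y s‖ ≤ bound s) (hint : Integrable bound μ) :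
    Integrable (fun s => deriv (fun y => F y s) x) μ ∧
      HasDerivAt (fun y => ∫ s, F y s ∂μ) (∫ s, deriv (fun y => F y s) x ∂μ) x := by
  have hx : x ∈ Metric.ball x r := Metric.mem_ball_self hr
  have hFx : Integrable (F x) μ :=
    hint.mono' (hmeas x hx) (hbound.mono fun s hs => hs x hx)
  refine hasDerivAt_integral_of_dominated_loc_of_deriv_le (F := F)
    (F' := fun y s => deriv (fun y => F y s) y)
    (bound := fun s => bound s / (r / 3)) (s := Metric.ball x (r / 3))
    (Metric.ball_mem_nhds x (by positivity))
    (Filter.eventually_of_mem (Metric.ball_mem_nhds x hr) hmeas) hFx ?_ ?_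
    (hint.div_const _) ?_
  · classical
    refine aestronglyMeasurable_of_tendsto_ae (𝓝[≠] x)
      (f := fun y s => if y ∈ Metric.ball x r then slope (fun y => F y s) x y else 0) ?_ ?_
    · intro y
      by_cases hy : y ∈ Metric.ball x r
      · simp only [hy, if_true, slope_def_field]
        simpa only [div_eq_mul_inv] using! ((hmeas y hy).sub (hmeas x hx)).mul_const (y - x)⁻¹
      · simpa only [hy, if_false] using aestronglyMeasurable_const
    · filter_upwards [hdiff] with s hd
      have h := hasDerivAt_iff_tendsto_slope.1
        (hd.differentiableAt (Metric.ball_mem_nhds x hr)).hasDerivAt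
      refine h.congr' ?_
      filter_upwards [mem_nhdsWithin_of_mem_nhds (Metric.ball_mem_nhds x hr)] with y hy
      rw [if_pos hy]
  · filter_upwards [hdiff, hbound] with s hd hb y hy
    have hsub : Metric.closedBall y (r / 3) ⊆ Metric.ball x r := by
      intro z hz
      rw [Metric.mem_closedBall] at hz
      rw [Metric.mem_ball] at hy ⊢
      linarith [dist_triangle z y x]
    refine Complex.norm_deriv_le_of_forall_mem_sphere_norm_le (by positivity) ?_
      fun z hz => hb z (hsub (Metric.sphere_subset_closedBall hz))
    exact (hd.mono hsub).diffContOnCl_ball subset_rfl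
  · filter_upwards [hdiff] with s hd y hy
    exact (hd.differentiableAt (Metric.isOpen_ball.mem_nhds
      (Metric.ball_subset_ball (by linarith) hy))).hasDerivAt

/-- The integrand of `J̃_{m,n}(y, y - d)`, written in terms of `s / y`. -/
noncomputable def JtKernel (m n : ℕ) (d y : ℂ) (s : ℝ) : ℂ :=
  (s : ℂ) ^ n *
    (LiExp m (2 * (π : ℂ) * d * (s / y)) / Complex.tanh ((π : ℂ) * (s / y)) -
      y / ((π : ℂ) * s) * LiExp m (2 * (π : ℂ) * s))

theorem Jtfun_eq_JtKernel (m n : ℕ) {d y : ℂ} (hy : y ≠ 0) :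
    Jtfun m n y (y - d) = JtKernel m n d y := by
  ext s
  have h1 : -(2 * (π : ℂ)) * (1 - (y - d) / y) * s = -(2 * (π : ℂ) * d * (s / y)) := by
    field_simp
    ring
  have h2 : -(2 * (π : ℂ)) * s = -(2 * (π : ℂ) * s) := by ring
  simp only [Jtfun, JtKernel, LiExp, h1, h2, mul_div_assoc]

theorem ofReal_div_re {s : ℝ} (y : ℂ) :
    ((s : ℂ) / y).re = s * y.re / Complex.normSq y := by
  simp [Complex.div_re]

theorem ofReal_div_re_ne_zero {s : ℝ} (hs : 0 < s) {y : ℂ} (hy : y.re ≠ 0) :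
    ((s : ℂ) / y).re ≠ 0 := by
  have hy0 : y ≠ 0 := by rintro rfl; simp at hy
  rw [ofReal_div_re]
  exact div_ne_zero (mul_ne_zero hs.ne' hy) (Complex.normSq_pos.2 hy0).ne'

theorem re_two_pi_mul_mul_div (d y : ℂ) (s : ℝ) :
    (2 * (π : ℂ) * d * (s / y)).re = 2 * π * (d / y).re * s := by
  have h : 2 * (π : ℂ) * d * (s / y) = ((2 * π * s : ℝ) : ℂ) * (d / y) := by
    push_cast; ring
  rw [h, Complex.re_ofReal_mul]
  ring

theorem differentiableAt_LiExp_div_tanh (p : ℕ) {d z : ℂ} (hz : z.re ≠ 0)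
    (hdz : 0 < (2 * (π : ℂ) * d * z).re) :
    DifferentiableAt ℂ
      (fun z => LiExp (p + 1) (2 * (π : ℂ) * d * z) / Complex.tanh ((π : ℂ) * z)) z := by
  have hre : ((π : ℂ) * z).re ≠ 0 := by
    rw [Complex.re_ofReal_mul]
    exact mul_ne_zero Real.pi_ne_zero hz
  have hs := Complex.sinh_ne_zero_of_re_ne_zero hre
  have h1 : DifferentiableAt ℂ (fun z => LiExp (p + 1) (2 * (π : ℂ) * d * z)) z :=
    (hasDerivAt_LiExp p hdz).differentiableAt.comp z (by fun_prop)
  simp only [Complex.tanh_eq_sinh_div_cosh, div_div_eq_mul_div]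
  exact (h1.mul (by fun_prop)).div (by fun_prop) hs

theorem hasDerivAt_LiExp_two_pi_mul (p : ℕ) {s : ℝ} (hs : 0 < s) :
    HasDerivAt (fun s : ℝ => LiExp (p + 1) (2 * (π : ℂ) * s))
      (-(2 * (π : ℂ) * LiExp p (2 * (π : ℂ) * s))) s := by
  have h0 : HasDerivAt (fun s : ℝ => 2 * (π : ℂ) * (s : ℂ)) (2 * (π : ℂ)) s := by
    simpa using ((hasDerivAt_id s).ofReal_comp).const_mul (2 * (π : ℂ))
  have h1 := (hasDerivAt_LiExp p (a := 2 * (π : ℂ) * s) (by simp; positivity)).comp s h0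
  convert! h1 using 1
  ring

/-- The Euler-type relation between the derivatives of the integrand
in the parameter and in the variable of integration. -/
theorem hasDerivAt_JtKernel (p n : ℕ) {d y : ℂ} {s : ℝ} (hs : 0 < s) (hy : y.re ≠ 0)
    (hd : 0 < (d / y).re) :
    DifferentiableAt ℂ (fun y => JtKernel (p + 1) n d y s) y ∧
      HasDerivAt (fun s : ℝ => (s : ℂ) * JtKernel (p + 1) n d y s)
        (((n : ℂ) + 1) * JtKernel (p + 1) n d y s +
          2 * y * ((s : ℂ) ^ n * LiExp p (2 * (π : ℂ) * s)) -
          y * deriv (fun y => JtKernel (p + 1) n d y s) y) s := by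
  have hy0 : y ≠ 0 := by rintro rfl; simp at hy
  have hs0 : (s : ℂ) ≠ 0 := by exact_mod_cast hs.ne'
  have hπ : (π : ℂ) ≠ 0 := by exact_mod_cast Real.pi_ne_zero
  have hA := (differentiableAt_LiExp_div_tanh p (ofReal_div_re_ne_zero hs hy)
    (by rw [re_two_pi_mul_mul_div]; positivity)).hasDerivAt
  set A : ℂ → ℂ :=
    fun z => LiExp (p + 1) (2 * (π : ℂ) * d * z) / Complex.tanh ((π : ℂ) * z) with hAdef
  have hy1 : HasDerivAt (fun y : ℂ => (s : ℂ) / y) (-(s : ℂ) / y ^ 2) y := by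
    simpa [div_eq_mul_inv] using (hasDerivAt_inv hy0).const_mul (s : ℂ)
  have hyd : HasDerivAt (fun y => JtKernel (p + 1) n d y s)
      ((s : ℂ) ^ n * (deriv A (s / y) * (-(s : ℂ) / y ^ 2) -
        1 / ((π : ℂ) * s) * LiExp (p + 1) (2 * (π : ℂ) * s))) y :=
    ((hA.comp y hy1).sub
      (((hasDerivAt_id y).div_const _).mul_const _)).const_mul _
  refine ⟨hyd.differentiableAt, ?_⟩
  have hcast : HasDerivAt (fun s : ℝ => (s : ℂ)) 1 s := by
    simpa using (hasDerivAt_id s).ofReal_comp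
  have hsA := hA.comp s (hcast.div_const y)
  have hL := hasDerivAt_LiExp_two_pi_mul p hs
  have hsd := ((hcast.pow (n + 1)).mul hsA).sub
    ((((hcast.pow n).mul hL)).const_mul (y / (π : ℂ)))
  rw [hyd.deriv]
  refine (hsd.congr_of_eventuallyEq ?_).congr_deriv ?_
  · filter_upwards [Ioi_mem_nhds hs] with u hu
    have hu0 : (u : ℂ) ≠ 0 := by exact_mod_cast (ne_of_gt hu)
    simp only [JtKernel, hAdef, Pi.sub_apply, Pi.mul_apply, Pi.pow_apply, Function.comp]
    field_simp
    ring
  · have hn : (n : ℂ) * (s : ℂ) ^ (n - 1) = n * ((s : ℂ) ^ n / s) := by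
      rcases n with _ | n
      · simp
      · simp [pow_succ, hs0]
    have hK : JtKernel (p + 1) n d y s = (s : ℂ) ^ n *
      (A (s / y) - y / ((π : ℂ) * s) * LiExp (p + 1) (2 * (π : ℂ) * s)) := rfl
    rw [hK]
    simp only [Pi.pow_apply, Function.comp, hn, Nat.add_sub_cancel]
    push_cast
    field_simp
    ring

theorem norm_JtKernel_le (p n : ℕ) (hpn : 1 ≤ p + n) {d y : ℂ} {s c K M D B : ℝ} (hs : 0 < s)
    (hc : 0 < c) (hy : y.re ≠ 0) (hK : ‖y‖ ≤ K * |y.re|) (hM : ‖y‖ ≤ M)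
    (hD : ‖2 * (π : ℂ) * (d / y) - 2 * π‖ ≤ D)
    (hcd : c ≤ 2 * π * (d / y).re) (hcπ : c ≤ 2 * π)
    (hB : ∀ (q : ℕ) (a : ℂ), c * s ≤ a.re → ‖LiExp (q + 1) a‖ ≤ B) :
    ‖JtKernel (p + 1) n d y s‖ ≤ (2 * K + 2 + M * (2 + D)) * ((s ^ n + s ^ (n - 1)) * B) := by
  have hy0 : y ≠ 0 := by rintro rfl; simp at hy
  have hs0 : (s : ℂ) ≠ 0 := by exact_mod_cast hs.ne'
  have hπ : (π : ℂ) ≠ 0 := by exact_mod_cast Real.pi_ne_zero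
  have hypos : 0 < |y.re| := abs_pos.2 hy
  have hKnn : 0 ≤ K := by
    by_contra h
    nlinarith [not_le.1 h, norm_nonneg y]
  have hMnn : 0 ≤ M := (norm_nonneg _).trans hM
  have hDnn : 0 ≤ D := (norm_nonneg _).trans hD
  set a : ℂ := 2 * (π : ℂ) * d * (s / y) with ha
  set b : ℂ := 2 * (π : ℂ) * s with hb
  set w : ℂ := (π : ℂ) * (s / y) with hw
  have hare : c * s ≤ a.re := by
    rw [ha, re_two_pi_mul_mul_div]; gcongr
  have hbre : c * s ≤ b.re := by
    have : b.re = 2 * π * s := by simp [hb]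
    rw [this]; gcongr
  have hBa := hB p a hare
  have hBb := hB p b hbre
  have hBnn : 0 ≤ B := (norm_nonneg _).trans hBa
  have hwre : w.re ≠ 0 := by
    rw [hw, Complex.re_ofReal_mul]
    exact mul_ne_zero Real.pi_ne_zero (ofReal_div_re_ne_zero hs hy)
  have hwK : ‖w‖ ≤ K * |w.re| := by
    have hyn : 0 < ‖y‖ := norm_pos_iff.2 hy0
    rw [hw, Complex.re_ofReal_mul, ofReal_div_re, norm_mul, norm_div, Complex.norm_real,
      Complex.norm_real, abs_mul, abs_div, abs_mul, Complex.normSq_eq_norm_sq,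
      abs_of_pos Real.pi_pos, abs_of_pos hs, abs_of_pos (by positivity : 0 < ‖y‖ ^ 2),
      Real.norm_of_nonneg Real.pi_pos.le, Real.norm_of_nonneg hs.le]
    have : K * (π * (s * |y.re| / ‖y‖ ^ 2)) - π * (s / ‖y‖)
        = π * s / ‖y‖ ^ 2 * (K * |y.re| - ‖y‖) := by
      field_simp
    have h2 : 0 ≤ π * s / ‖y‖ ^ 2 * (K * |y.re| - ‖y‖) :=
      mul_nonneg (by positivity) (by linarith)
    linarith
  have hcoth := Complex.norm_inv_tanh_sub_inv_le hwre hwK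
  have hdecomp : JtKernel (p + 1) n d y s = (s : ℂ) ^ n *
      (LiExp (p + 1) a * (1 / Complex.tanh w - 1 / w)) +
      y / (π : ℂ) * ((s : ℂ) ^ n / s * (LiExp (p + 1) a - LiExp (p + 1) b)) := by
    have hw1 : 1 / w = y / ((π : ℂ) * s) := by rw [hw]; field_simp
    rw [JtKernel, ← ha, ← hb, ← hw, hw1]
    field_simp
    ring
  have hfirst : ‖(s : ℂ) ^ n * (LiExp (p + 1) a * (1 / Complex.tanh w - 1 / w))‖
      ≤ (2 * K + 2) * (s ^ n * B) := by
    rw [norm_mul, norm_mul, norm_pow, Complex.norm_real, Real.norm_of_nonneg hs.le]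
    calc _ ≤ s ^ n * (B * (2 * K + 2)) := by gcongr
      _ = _ := by ring
  have hsecond : ‖(s : ℂ) ^ n / s * (LiExp (p + 1) a - LiExp (p + 1) b)‖
      ≤ (2 + D) * (s ^ (n - 1) * B) := by
    rw [norm_mul, norm_div, norm_pow, Complex.norm_real, Real.norm_of_nonneg hs.le]
    rcases n with _ | n
    · obtain ⟨q, rfl⟩ : ∃ q, p = q + 1 := ⟨p - 1, by lia⟩
      have h := norm_LiExp_sub_le (by positivity) (hB q) hare hbre
      have hab : ‖a - b‖ ≤ D * s := by
        have : a - b = (2 * (π : ℂ) * (d / y) - 2 * π) * s := by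
          rw [ha, hb]; ring
        rw [this, norm_mul, Complex.norm_real, Real.norm_of_nonneg hs.le]
        gcongr
      calc _ ≤ s ^ 0 / s * (B * (D * s)) := by gcongr; exact h.trans (by gcongr)
        _ = D * B := by field_simp
        _ ≤ _ := by simp; nlinarith
    · have h : ‖LiExp (p + 1) a - LiExp (p + 1) b‖ ≤ 2 * B :=
        (norm_sub_le _ _).trans (by linarith)
      have h2 : s ^ (n + 1) / s = s ^ n := by rw [pow_succ]; field_simp
      rw [h2, Nat.add_sub_cancel]
      calc _ ≤ s ^ n * (2 * B) := by gcongr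
        _ ≤ _ := by nlinarith [show 0 ≤ D * (s ^ n * B) by positivity]
  have hyπ : ‖y / (π : ℂ)‖ ≤ M := by
    rw [norm_div, Complex.norm_real, Real.norm_of_nonneg Real.pi_pos.le]
    exact (div_le_self (norm_nonneg _) (by linarith [Real.pi_gt_three])).trans hM
  rw [hdecomp]
  refine (norm_add_le _ _).trans ?_
  rw [norm_mul (y / (π : ℂ))]
  calc _ ≤ (2 * K + 2) * (s ^ n * B) + M * ((2 + D) * (s ^ (n - 1) * B)) := by gcongr
    _ ≤ _ := by
      have h1 : 0 ≤ (2 * K + 2) * (s ^ (n - 1) * B) := by positivity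
      have h2 : 0 ≤ M * (2 + D) * (s ^ n * B) := by positivity
      linarith

theorem exists_ball_norm_JtKernel_le (p n : ℕ) (hpn : 1 ≤ p + n) {d x : ℂ} (hx : x.re ≠ 0)
    (hd : 0 < (d / x).re) : ∃ r c C : ℝ, 0 < r ∧ 0 < c ∧ ∀ y ∈ Metric.ball x r,
      y.re ≠ 0 ∧ 0 < (d / y).re ∧ ∀ s : ℝ, 0 < s → ‖JtKernel (p + 1) n d y s‖ ≤
        C * ((s ^ ((n : ℝ) - 1 / 2) + s ^ (((n - 1 : ℕ) : ℝ) - 1 / 2)) * Real.exp (-c * s)) := by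
  have hx0 : x ≠ 0 := by rintro rfl; simp at hx
  have hxpos : 0 < |x.re| := abs_pos.2 hx
  obtain ⟨B, hB⟩ := exists_norm_LiExp_succ_le
  set K : ℝ := ‖x‖ / |x.re| + 1 with hK
  set c : ℝ := min (π * (d / x).re) (2 * π) with hc
  have hcpos : 0 < c := lt_min (by positivity) (by positivity)
  set D : ℝ := ‖2 * (π : ℂ) * (d / x) - 2 * π‖ + 1 with hD
  have hdiv : ContinuousAt (fun y : ℂ => d / y) x := continuousAt_const.div continuousAt_id hx0
  have hre : ContinuousAt (fun y : ℂ => |y.re|) x := by fun_prop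
  have e1 : ∀ᶠ y : ℂ in 𝓝 x, 0 < |y.re| := hre.eventually_const_lt hxpos
  have e2 : ∀ᶠ y : ℂ in 𝓝 x, π * (d / x).re < 2 * π * (d / y).re := by
    have : ContinuousAt (fun y : ℂ => 2 * π * (d / y).re) x :=
      continuousAt_const.mul (Complex.continuous_re.continuousAt.comp hdiv)
    exact this.eventually_const_lt (by nlinarith [mul_pos Real.pi_pos hd])
  have e3 : ∀ᶠ y : ℂ in 𝓝 x, ‖y‖ < K * |y.re| := by
    have h1 : ContinuousAt (fun y : ℂ => K * |y.re|) x := by fun_prop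
    refine continuous_norm.continuousAt.eventually_lt h1 ?_
    rw [hK, add_mul, div_mul_cancel₀ _ hxpos.ne']
    linarith
  have e4 : ∀ᶠ y : ℂ in 𝓝 x, ‖y‖ < ‖x‖ + 1 :=
    continuous_norm.continuousAt.eventually_lt_const (by linarith)
  have e5 : ∀ᶠ y : ℂ in 𝓝 x, ‖2 * (π : ℂ) * (d / y) - 2 * π‖ < D := by
    have : ContinuousAt (fun y : ℂ => ‖2 * (π : ℂ) * (d / y) - 2 * π‖) x :=
      ((continuousAt_const.mul hdiv).sub continuousAt_const).norm
    exact this.eventually_lt_const (by linarith)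
  obtain ⟨r, hr, hball⟩ := Metric.eventually_nhds_iff_ball.1
    (e1.and (e2.and (e3.and (e4.and e5))))
  refine ⟨r, c / 2, (2 * K + 2 + (‖x‖ + 1) * (2 + D)) * (B * c ^ (-(1 / 2) : ℝ)), hr,
    half_pos hcpos, fun y hy => ?_⟩
  obtain ⟨h1, h2, h3, h4, h5⟩ := hball y hy
  have hyre : y.re ≠ 0 := abs_pos.1 h1
  have hdy : 0 < (d / y).re := by
    have : 0 < 2 * π * (d / y).re := lt_trans (by positivity) h2
    exact pos_of_mul_pos_right this (by positivity)
  refine ⟨hyre, hdy, fun s hs => ?_⟩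
  have h := norm_JtKernel_le p n hpn hs hcpos hyre h3.le h4.le h5.le
    ((min_le_left _ _).trans h2.le) (min_le_right _ _)
    (fun q a ha => hB q (c * s) (by positivity) a ha)
  refine h.trans (le_of_eq ?_)
  rw [Real.mul_rpow hcpos.le hs.le, sub_eq_add_neg, sub_eq_add_neg, Real.rpow_add hs,
    Real.rpow_add hs, Real.rpow_natCast, Real.rpow_natCast]
  ring_nf

theorem integral_Ioi_eq_zero_of_norm_le {f f' : ℝ → ℂ} {c C : ℝ} {k l : ℕ} (hc : 0 < c)
    (hderiv : ∀ s ∈ Ioi (0 : ℝ), HasDerivAt (fun s : ℝ => (s : ℂ) * f s) (f' s) s)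
    (hint : IntegrableOn f' (Ioi 0))
    (hf : ∀ s : ℝ, 0 < s → ‖f s‖ ≤
      C * ((s ^ ((k : ℝ) - 1 / 2) + s ^ ((l : ℝ) - 1 / 2)) * Real.exp (-c * s))) :
    ∫ s in Ioi (0 : ℝ), f' s = 0 := by
  set h : ℝ → ℝ := fun s =>
    C * (s ^ ((k : ℝ) + 1 / 2) * Real.exp (-c * s) + s ^ ((l : ℝ) + 1 / 2) * Real.exp (-c * s))
    with hh
  have hle : ∀ s : ℝ, 0 < s → ‖(s : ℂ) * f s‖ ≤ h s := by
    intro s hs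
    rw [norm_mul, Complex.norm_real, Real.norm_of_nonneg hs.le]
    refine (mul_le_mul_of_nonneg_left (hf s hs) hs.le).trans (le_of_eq ?_)
    have e : ∀ k : ℕ, s ^ ((k : ℝ) + 1 / 2) = s * s ^ ((k : ℝ) - 1 / 2) := by
      intro k
      rw [← Real.rpow_one_add' hs.le (by
        intro h0
        have : (0 : ℝ) ≤ k := k.cast_nonneg
        linarith)]
      ring_nf
    simp only [hh, e]
    ring
  have hle' : ∀ s ∈ Ici (0 : ℝ), ‖(s : ℂ) * f s‖ ≤ h s := by
    intro s hs
    rcases (mem_Ici.1 hs).eq_or_lt with rfl | hs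
    · simp only [hh]
      rw [Real.zero_rpow (by positivity), Real.zero_rpow (by positivity)]
      simp
    · exact hle s hs
  have hcont : ContinuousWithinAt (fun s : ℝ => (s : ℂ) * f s) (Ici 0) 0 := by
    have hh0 : Tendsto h (𝓝[≥] 0) (𝓝 0) := by
      have hc' : Continuous h := by
        have e : ∀ k : ℕ, Continuous fun s : ℝ => s ^ ((k : ℝ) + 1 / 2) :=
          fun k => Real.continuous_rpow_const (by positivity)
        exact continuous_const.mul (((e k).mul (by fun_prop)).add ((e l).mul (by fun_prop)))
      have h0 : h 0 = 0 := by
        simp only [hh]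
        rw [Real.zero_rpow (by positivity), Real.zero_rpow (by positivity)]
        simp
      simpa [h0] using (hc'.tendsto 0).mono_left nhdsWithin_le_nhds
    have := squeeze_zero_norm' (eventually_nhdsWithin_of_forall hle') hh0
    simpa [ContinuousWithinAt] using this
  have htop : Tendsto (fun s : ℝ => (s : ℂ) * f s) atTop (𝓝 0) := by
    refine squeeze_zero_norm' ((eventually_gt_atTop 0).mono hle) ?_
    simpa [hh] using ((tendsto_rpow_mul_exp_neg_mul_atTop_nhds_zero ((k : ℝ) + 1 / 2) c hc).add
      (tendsto_rpow_mul_exp_neg_mul_atTop_nhds_zero ((l : ℝ) + 1 / 2) c hc)).const_mul C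
  simpa using integral_Ioi_of_hasDerivAt_of_tendsto hcont hderiv hint htop

theorem hasDerivAt_integral_JtKernel (p n : ℕ) (hpn : 1 ≤ p + n) {d x : ℂ} (hx : x.re ≠ 0)
    (hd : 0 < (d / x).re) :
    HasDerivAt (fun y => ∫ s in Ioi (0 : ℝ), JtKernel (p + 1) n d y s)
      (((n : ℂ) + 1) / x * (∫ s in Ioi (0 : ℝ), JtKernel (p + 1) n d x s) +
        (Nat.factorial n : ℂ) * riemannZeta ((p + 1 + n : ℕ) : ℂ) /
          ((π : ℂ) * (2 * (π : ℂ)) ^ n)) x := by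
  have hx0 : x ≠ 0 := by rintro rfl; simp at hx
  have hπ : (π : ℂ) ≠ 0 := by exact_mod_cast Real.pi_ne_zero
  obtain ⟨r, c, C, hr, hc, hball⟩ := exists_ball_norm_JtKernel_le p n hpn hx hd
  have hxb : x ∈ Metric.ball x r := Metric.mem_ball_self hr
  have hbint : ∀ k : ℕ, IntegrableOn
      (fun s : ℝ => s ^ ((k : ℝ) - 1 / 2) * Real.exp (-c * s)) (Ioi 0) := by
    intro k
    have := integrableOn_rpow_mul_exp_neg_mul_rpow (p := 1) (s := (k : ℝ) - 1 / 2) (b := c)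
      (by linarith [k.cast_nonneg (α := ℝ)]) one_pos hc
    simpa using this
  have hint : IntegrableOn (fun s : ℝ => C * ((s ^ ((n : ℝ) - 1 / 2) +
      s ^ (((n - 1 : ℕ) : ℝ) - 1 / 2)) * Real.exp (-c * s))) (Ioi 0) := by
    simp only [add_mul]
    exact ((hbint n).add (hbint (n - 1))).const_mul C
  have hmeas : ∀ y ∈ Metric.ball x r,
      AEStronglyMeasurable (JtKernel (p + 1) n d y) (volume.restrict (Ioi 0)) := by
    intro y hy
    obtain ⟨h1, h2, -⟩ := hball y hy
    refine ContinuousOn.aestronglyMeasurable (fun s hs => ?_) measurableSet_Ioi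
    have hs0 : (s : ℂ) ≠ 0 := by exact_mod_cast (ne_of_gt hs)
    have h := (hasDerivAt_JtKernel p n hs h1 h2).2.continuousAt
    have h' : ContinuousAt (fun u : ℝ => (u : ℂ) * JtKernel (p + 1) n d y u / u) s :=
      h.div Complex.continuous_ofReal.continuousAt hs0
    refine (h'.congr ?_).continuousWithinAt
    filter_upwards [Ioi_mem_nhds hs] with u hu
    exact mul_div_cancel_left₀ _ (by exact_mod_cast (ne_of_gt hu))
  obtain ⟨hdint, hderiv⟩ := Complex.hasDerivAt_integral_of_norm_le
    (μ := volume.restrict (Ioi 0)) (F := JtKernel (p + 1) n d) hr hmeas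
    (by
      filter_upwards [self_mem_ae_restrict measurableSet_Ioi] with s hs y hy
      exact (hasDerivAt_JtKernel p n hs (hball y hy).1
        (hball y hy).2.1).1.differentiableWithinAt)
    (by
      filter_upwards [self_mem_ae_restrict measurableSet_Ioi] with s hs y hy
      exact (hball y hy).2.2 s hs)
    hint
  have hGint : IntegrableOn (JtKernel (p + 1) n d x) (Ioi 0) :=
    hint.mono' (hmeas x hxb) (by
      filter_upwards [self_mem_ae_restrict measurableSet_Ioi] with s hs
      exact (hball x hxb).2.2 s hs)
  have hLint := integrableOn_pow_mul_LiExp p n hpn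
  have i1 := hGint.const_mul ((n : ℂ) + 1)
  have i2 := hLint.const_mul (2 * x)
  have i3 := hdint.const_mul x
  have hzero := integral_Ioi_eq_zero_of_norm_le hc
    (fun s hs => (hasDerivAt_JtKernel p n hs hx hd).2) ((i1.add i2).sub i3)
    (hball x hxb).2.2
  rw [integral_sub (i1.fun_add i2) i3, integral_add i1 i2] at hzero
  simp only [integral_const_mul] at hzero
  rw [integral_pow_mul_LiExp p n hpn] at hzero
  refine hderiv.congr_deriv ?_
  have hfin := sub_eq_zero.1 hzero
  rw [← mul_right_inj' hx0, ← hfin]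
  field_simp
  ring

theorem stmt7 (m n : ℕ) (hm : 1 ≤ m) (hmn : 2 ≤ m + n) (x ξ : ℂ)
    (hx : x.re ≠ 0) (hξ : (ξ / x).re < 1) :
    HasDerivAt (fun t : ℂ => Jt m n (x + t) (ξ + t))
      (((n : ℂ) + 1) / x * Jt m n x ξ +
        (-1 : ℂ) ^ (m + n + 1) * (Nat.factorial n : ℂ) * riemannZeta ((m + n : ℕ) : ℂ) /
          ((π : ℂ) * (2 * (π : ℂ)) ^ n)) 0 := by
  obtain ⟨p, rfl⟩ : ∃ p, m = p + 1 := ⟨m - 1, by lia⟩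
  have hx0 : x ≠ 0 := by rintro rfl; simp at hx
  have hd : 0 < ((x - ξ) / x).re := by
    rw [sub_div, div_self hx0]
    simpa using hξ
  have hJt : ∀ t : ℂ, x + t ≠ 0 → Jt (p + 1) n (x + t) (ξ + t) = (-1 : ℂ) ^ (n + (p + 1) + 1) *
      ∫ s in Ioi (0 : ℝ), JtKernel (p + 1) n (x - ξ) (x + t) s := by
    intro t ht
    rw [Jt, ← Jtfun_eq_JtKernel _ _ ht, show x + t - (x - ξ) = ξ + t by ring]
  have hI := hasDerivAt_integral_JtKernel p n (d := x - ξ) (x := x + 0) (by lia)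
    (by rwa [add_zero]) (by rwa [add_zero])
  have h := (hI.comp_const_add x 0).const_mul ((-1 : ℂ) ^ (n + (p + 1) + 1))
  refine (h.congr_of_eventuallyEq ?_).congr_deriv ?_
  · have : ∀ᶠ t : ℂ in 𝓝 0, x + t ≠ 0 :=
      (continuous_const.add continuous_id).continuousAt.eventually_ne (by simpa using hx0)
    filter_upwards [this] with t ht using hJt t ht
  · have h0 := hJt 0 (by simpa using hx0)
    simp only [add_zero] at h0 ⊢
    rw [h0, add_comm n (p + 1)]
    ring
end

section
/- Let α ∈ ℂ with 0 < Re α < 1. Then the principal value integral P.v. ∫_0^∞ y^{α−1}/(1 − y) dy exists and equals π·cot(πα); that is, lim_{ε→0⁺} ( ∫_0^{1−ε} y^{α−1}/(1 − y) dy + ∫_{1+ε}^∞ y^{α−1}/(1 − y) dy ) = π·cot(πα). -/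
open MeasureTheory Real Filter

/-- The difference `y ^ (α - 1) - y ^ (-α)`, obtained by folding `(1, ∞)` onto `(0, 1)`, is
divisible by `1 - y` up to an integrable factor. -/
lemma intervalIntegrable_cpow_sub_cpow_div_one_sub {α : ℂ} (h0 : 0 < α.re) (h1 : α.re < 1) :
    IntervalIntegrable
      (fun y : ℝ => ((y : ℂ) ^ (α - 1) - (y : ℂ) ^ (-α)) / (1 - (y : ℂ))) volume 0 1 := by
  set g : ℝ → ℂ := fun y => (y : ℂ) ^ (α - 1) - (y : ℂ) ^ (-α) with hg
  have hα0 : -α ≠ 0 := fun h => by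
    have := congrArg Complex.re h
    simp at this
    linarith
  have hα1 : α - 1 ≠ 0 := fun h => by
    have := congrArg Complex.re h
    simp at this
    linarith
  have hdiff : ∀ y : ℝ, y ≠ 0 → DifferentiableAt ℝ g y := fun y hy =>
    ((hasDerivAt_ofReal_cpow_const hy hα1).sub
      (hasDerivAt_ofReal_cpow_const hy hα0)).differentiableAt
  have hint : IntervalIntegrable g volume 0 (1 / 2) :=
    (intervalIntegral.intervalIntegrable_cpow' (by simpa using h0)).sub
      (intervalIntegral.intervalIntegrable_cpow' (by simpa using h1))
  have hleft : IntervalIntegrable (fun y : ℝ => g y / (1 - (y : ℂ))) volume 0 (1 / 2) := by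
    simp_rw [div_eq_mul_inv]
    refine hint.mul_continuousOn (ContinuousOn.inv₀ (by fun_prop) fun y hy => ?_)
    rw [Set.uIcc_of_le (by norm_num)] at hy
    have : 1 - y ≠ 0 := by linarith [hy.2]
    exact_mod_cast this
  have hslope : ContinuousOn (dslope g 1) (Set.Ioi 0) :=
    (continuousOn_dslope (Ioi_mem_nhds one_pos)).2
      ⟨fun y hy => (hdiff y (ne_of_gt hy)).continuousAt.continuousWithinAt,
        hdiff 1 one_ne_zero⟩
  have hright : IntervalIntegrable (fun y : ℝ => g y / (1 - (y : ℂ))) volume (1 / 2) 1 := by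
    have hi : IntervalIntegrable (fun y => -dslope g 1 y) volume (1 / 2) 1 := by
      refine (hslope.mono fun y hy => ?_).neg.intervalIntegrable
      rw [Set.uIcc_of_le (by norm_num)] at hy
      exact lt_of_lt_of_le (by norm_num) hy.1
    refine hi.congr_uIoo fun y hy => ?_
    rw [Set.uIoo_of_le (by norm_num)] at hy
    have hy1 : (y : ℂ) - 1 ≠ 0 := by
      have : y - 1 ≠ 0 := by linarith [hy.2]
      exact_mod_cast this
    have hy2 : 1 - (y : ℂ) ≠ 0 := by rw [← neg_sub]; exact neg_ne_zero.2 hy1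
    have hg1 : g 1 = 0 := by simp [hg]
    simp only [dslope_of_ne g hy.2.ne, slope, vsub_eq_sub, hg1, sub_zero, Complex.real_smul]
    push_cast
    field_simp
    ring
  exact hleft.trans hright

/-- Partial sums of the partial fraction expansion of the cotangent, with the terms grouped as
they arise from expanding `1 / (1 - y)` in a geometric series. -/
lemma tendsto_sum_inv_sub_inv_cot {α : ℂ} (h0 : 0 < α.re) (h1 : α.re < 1) :
    Tendsto (fun N : ℕ => ∑ n ∈ Finset.range N, (1 / (α + n) - 1 / (n + 1 - α))) atTop
      (nhds (π * Complex.cot (π * α))) := by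
  have hα : α ∈ Complex.integerComplement := by
    rintro ⟨n, hn⟩
    have : (n : ℝ) = α.re := by rw [← hn]; simp
    rw [← this] at h0 h1
    norm_cast at h0 h1
    lia
  have hinv : Tendsto (fun N : ℕ => 1 / (α + N)) atTop (nhds 0) := by
    refine squeeze_zero_norm' ?_ (tendsto_inv_atTop_nhds_zero_nat (𝕜 := ℝ))
    filter_upwards [eventually_gt_atTop 0] with N hN
    have hN' : (0 : ℝ) < N := by exact_mod_cast hN
    rw [norm_div, norm_one, one_div]
    refine inv_anti₀ hN' (le_trans ?_ (Complex.re_le_norm _))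
    simp [h0.le]
  have hsum := ((tendsto_logDeriv_euler_cot_sub hα).add_const (1 / α)).sub hinv
  simp only [sub_add_cancel, sub_zero] at hsum
  refine hsum.congr fun N => ?_
  induction N with
  | zero => simp
  | succ N ih =>
    rw [Finset.sum_range_succ, Finset.sum_range_succ, ← ih, cotTerm,
      ← neg_sub ((N : ℂ) + 1) α, one_div_neg_eq_neg_one_div]
    push_cast
    ring

lemma integral_cpow_sub_cpow_div_one_sub {α : ℂ} (h0 : 0 < α.re) (h1 : α.re < 1) :
    ∫ y in (0 : ℝ)..1, ((y : ℂ) ^ (α - 1) - (y : ℂ) ^ (-α)) / (1 - (y : ℂ)) =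
      π * Complex.cot (π * α) := by
  set F : ℝ → ℂ := fun y => ((y : ℂ) ^ (α - 1) - (y : ℂ) ^ (-α)) / (1 - (y : ℂ)) with hF
  have hFint : IntervalIntegrable F volume 0 1 :=
    intervalIntegrable_cpow_sub_cpow_div_one_sub h0 h1
  have hmul : ∀ N : ℕ, IntervalIntegrable (fun y : ℝ => F y * (y : ℂ) ^ N) volume 0 1 :=
    fun N => hFint.mul_continuousOn (by fun_prop)
  have hzero : Tendsto (fun N : ℕ => ∫ y in (0 : ℝ)..1, F y * (y : ℂ) ^ N) atTop (nhds 0) := by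
    rw [← intervalIntegral.integral_zero (a := 0) (b := 1) (μ := volume) (E := ℂ)]
    refine intervalIntegral.tendsto_integral_filter_of_dominated_convergence (fun y => ‖F y‖)
      (Eventually.of_forall fun N => ?_) (Eventually.of_forall fun N => ?_) hFint.norm ?_
    · rw [Set.uIoc_of_le zero_le_one]
      exact (hmul N).aestronglyMeasurable
    · refine Eventually.of_forall fun y hy => ?_
      rw [Set.uIoc_of_le zero_le_one] at hy
      rw [norm_mul, norm_pow, Complex.norm_of_nonneg hy.1.le]
      exact mul_le_of_le_one_right (norm_nonneg _) (pow_le_one₀ hy.1.le hy.2)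
    · filter_upwards [Measure.ae_ne volume (1 : ℝ)] with y hy1 hy
      rw [Set.uIoc_of_le zero_le_one] at hy
      have hlt : ‖(y : ℂ)‖ < 1 := by
        rw [Complex.norm_of_nonneg hy.1.le]
        exact lt_of_le_of_ne hy.2 hy1
      simpa using (tendsto_pow_atTop_nhds_zero_of_norm_lt_one hlt).const_mul (F y)
  have hpartial : ∀ N : ℕ, ∑ n ∈ Finset.range N, (1 / (α + n) - 1 / (n + 1 - α)) =
      (∫ y in (0 : ℝ)..1, F y) - ∫ y in (0 : ℝ)..1, F y * (y : ℂ) ^ N := by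
    intro N
    have ha : ∀ n : ℕ, -1 < (α - 1 + n).re := fun n => by
      have : (0 : ℝ) ≤ n := n.cast_nonneg
      simp; linarith
    have hb : ∀ n : ℕ, -1 < (-α + n).re := fun n => by
      have : (0 : ℝ) ≤ n := n.cast_nonneg
      simp; linarith
    have hterm : ∀ n : ℕ, 1 / (α + n) - 1 / (n + 1 - α) =
        ∫ y in (0 : ℝ)..1, ((y : ℂ) ^ (α - 1 + n) - (y : ℂ) ^ (-α + n)) := by
      intro n
      have hane : α - 1 + n + 1 ≠ 0 := fun h => by
        have h' := congrArg Complex.re h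
        have := ha n
        simp at h' this
        linarith
      have hbne : -α + n + 1 ≠ 0 := fun h => by
        have h' := congrArg Complex.re h
        have := hb n
        simp at h' this
        linarith
      rw [intervalIntegral.integral_sub (intervalIntegral.intervalIntegrable_cpow' (ha n))
        (intervalIntegral.intervalIntegrable_cpow' (hb n)), integral_cpow (Or.inl (ha n)),
        integral_cpow (Or.inl (hb n))]
      simp only [Complex.ofReal_one, Complex.one_cpow, Complex.ofReal_zero,
        Complex.zero_cpow hane, Complex.zero_cpow hbne, sub_zero]
      congr 2 <;> ring
    simp_rw [hterm]
    rw [← intervalIntegral.integral_finsetSum fun n _ =>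
        (intervalIntegral.intervalIntegrable_cpow' (ha n)).sub
          (intervalIntegral.intervalIntegrable_cpow' (hb n)),
      ← intervalIntegral.integral_sub hFint (hmul N)]
    refine intervalIntegral.integral_congr_uIoo fun y hy => ?_
    rw [Set.uIoo_of_le zero_le_one] at hy
    have hy0 : (y : ℂ) ≠ 0 := by exact_mod_cast hy.1.ne'
    have hy1 : 1 - (y : ℂ) ≠ 0 := by
      have : 1 - y ≠ 0 := by linarith [hy.2]
      exact_mod_cast this
    have hgeom := geom_sum_mul_neg (y : ℂ) N
    simp only [Complex.cpow_add _ _ hy0, Complex.cpow_natCast, ← sub_mul, ← Finset.mul_sum, hF]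
    rw [← mul_one_sub, ← hgeom]
    field_simp
  have hlim := hzero.const_sub (∫ y in (0 : ℝ)..1, F y)
  rw [sub_zero] at hlim
  exact tendsto_nhds_unique hlim
    ((tendsto_sum_inv_sub_inv_cot h0 h1).congr hpartial)

/-- The substitution `y ↦ y⁻¹` in the part of the integral beyond `1`. -/
lemma integral_Ioi_cpow_div_one_sub (α : ℂ) {c : ℝ} (hc : 1 ≤ c) :
    ∫ y in Set.Ioi c, (y : ℂ) ^ (α - 1) / (1 - (y : ℂ)) =
      -∫ y in (0 : ℝ)..c⁻¹, (y : ℂ) ^ (-α) / (1 - (y : ℂ)) := by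
  have hc0 : 0 < c := one_pos.trans_le hc
  have himage : Set.Ioi c = (fun y : ℝ => y⁻¹) '' Set.Ioo 0 c⁻¹ := by
    rw [Set.image_inv_eq_inv, Set.inv_Ioo_0_left (inv_pos.2 hc0), inv_inv]
  rw [himage, integral_image_eq_integral_abs_deriv_smul measurableSet_Ioo
    (fun y hy => (hasDerivAt_inv hy.1.ne').hasDerivWithinAt) inv_injective.injOn,
    intervalIntegral.integral_of_le (inv_pos.2 hc0).le, integral_Ioc_eq_integral_Ioo,
    ← integral_neg]
  refine setIntegral_congr_fun measurableSet_Ioo fun y hy => ?_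
  have hylt : y < 1 := hy.2.trans_le (inv_le_one_of_one_le₀ hc)
  have hy0 : (y : ℂ) ≠ 0 := by exact_mod_cast hy.1.ne'
  have hy1 : 1 - (y : ℂ) ≠ 0 := by
    have : 1 - y ≠ 0 := by linarith
    exact_mod_cast this
  have hy2 : (y : ℂ) - 1 ≠ 0 := by rw [← neg_sub]; exact neg_ne_zero.2 hy1
  have harg : (y : ℂ).arg ≠ π := by
    rw [Complex.arg_ofReal_of_nonneg hy.1.le]
    exact pi_pos.ne
  have hsq : |(-(y ^ 2)⁻¹)| = (y ^ 2)⁻¹ := by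
    rw [abs_neg, abs_of_nonneg (by positivity)]
  have hpow : (y : ℂ) ^ (-(α - 1)) = (y : ℂ) ^ (-α) * y := by
    rw [neg_sub, sub_eq_neg_add, Complex.cpow_add _ _ hy0, Complex.cpow_one]
  have hinv : 1 - (y : ℂ)⁻¹ = -((1 - (y : ℂ)) / y) := by
    field_simp
    ring
  simp only [hsq, Complex.real_smul, Complex.ofReal_inv, Complex.ofReal_pow]
  rw [Complex.inv_cpow _ _ harg, ← Complex.cpow_neg, hpow, hinv]
  field_simp

/-- The interval between `1 - ε` and `(1 + ε)⁻¹` has length `O(ε ^ 2)` while its distance to the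
singularity is of order `ε`, so it does not contribute in the limit. -/
lemma tendsto_integral_one_sub_inv_one_add {α : ℂ} (h1 : α.re < 1) :
    Tendsto (fun ε : ℝ => ∫ y in (1 - ε)..(1 + ε)⁻¹, (y : ℂ) ^ (-α) / (1 - (y : ℂ)))
      (nhdsWithin 0 (Set.Ioi 0)) (nhds 0) := by
  have hlim : Tendsto (fun ε : ℝ => 2 * ε) (nhdsWithin 0 (Set.Ioi 0)) (nhds 0) := by
    have : Tendsto (fun ε : ℝ => 2 * ε) (nhds 0) (nhds (2 * 0)) :=
      (continuous_const.mul continuous_id).tendsto 0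
    rw [mul_zero] at this
    exact this.mono_left nhdsWithin_le_nhds
  refine squeeze_zero_norm' ?_ hlim
  filter_upwards [Ioo_mem_nhdsGT (show (0 : ℝ) < 1 / 2 by norm_num)] with ε hε
  obtain ⟨hε0, hε1⟩ := hε
  have hpos : 0 < 1 + ε := by linarith
  have hlen : (1 + ε)⁻¹ - (1 - ε) = ε ^ 2 / (1 + ε) := by field_simp; ring
  have hdist : 1 - (1 + ε)⁻¹ = ε / (1 + ε) := by field_simp; ring
  have hle : 1 - ε ≤ (1 + ε)⁻¹ := by
    have : 0 ≤ ε ^ 2 / (1 + ε) := by positivity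
    linarith
  have hbound : ∀ y ∈ Set.uIoc (1 - ε) (1 + ε)⁻¹,
      ‖(y : ℂ) ^ (-α) / (1 - (y : ℂ))‖ ≤ 2 / (ε / (1 + ε)) := by
    intro y hy
    rw [Set.uIoc_of_le hle] at hy
    have hy0 : 1 / 2 < y := by linarith [hy.1]
    have hypos : 0 < y := by linarith
    have hd : ε / (1 + ε) ≤ 1 - y := by linarith [hy.2]
    have hdpos : 0 < ε / (1 + ε) := by positivity
    have hy1 : y ≤ 1 := by linarith
    have hnum : ‖(y : ℂ) ^ (-α)‖ ≤ 2 := by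
      rw [Complex.norm_cpow_eq_rpow_re_of_pos hypos]
      calc y ^ (-α).re ≤ y ^ (-1 : ℝ) :=
            rpow_le_rpow_of_exponent_ge hypos hy1 (by simpa using h1.le)
        _ = y⁻¹ := rpow_neg_one y
        _ ≤ 2 := by
            rw [inv_le_comm₀ hypos two_pos]
            linarith
    have hden : ‖1 - (y : ℂ)‖ = 1 - y := by
      rw [← Complex.ofReal_one, ← Complex.ofReal_sub, Complex.norm_of_nonneg (by linarith)]
    rw [norm_div, hden]
    exact div_le_div₀ zero_le_two hnum hdpos hd
  refine (intervalIntegral.norm_integral_le_of_norm_le_const hbound).trans_eq ?_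
  rw [hlen, abs_of_nonneg (by positivity)]
  field_simp

theorem stmt18 (α : ℂ) (h0 : 0 < α.re) (h1 : α.re < 1) :
    Tendsto (fun ε : ℝ =>
        (∫ y in (0 : ℝ)..(1 - ε), (y : ℂ) ^ (α - 1) / (1 - (y : ℂ))) +
          ∫ y in Set.Ioi (1 + ε : ℝ), (y : ℂ) ^ (α - 1) / (1 - (y : ℂ)))
      (nhdsWithin 0 (Set.Ioi 0))
      (nhds ((π : ℂ) * Complex.cot ((π : ℂ) * α))) := by
  have hFint := intervalIntegrable_cpow_sub_cpow_div_one_sub h0 h1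
  have hmem : ∀ᶠ ε : ℝ in nhdsWithin 0 (Set.Ioi 0), ε ∈ Set.Ioo (0 : ℝ) 1 :=
    Ioo_mem_nhdsGT one_pos
  have hprim := intervalIntegral.continuousOn_primitive_interval' hFint Set.left_mem_uIcc
    1 Set.right_mem_uIcc
  have hsub : Tendsto (fun ε : ℝ => 1 - ε) (nhdsWithin 0 (Set.Ioi 0))
      (nhdsWithin 1 (Set.uIcc 0 1)) := by
    refine tendsto_nhdsWithin_iff.2 ⟨?_, ?_⟩
    · have : Tendsto (fun ε : ℝ => 1 - ε) (nhds 0) (nhds (1 - 0)) :=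
        (continuous_const.sub continuous_id).tendsto 0
      rw [sub_zero] at this
      exact this.mono_left nhdsWithin_le_nhds
    · filter_upwards [hmem] with ε hε
      rw [Set.uIcc_of_le zero_le_one]
      exact ⟨by linarith [hε.2], by linarith [hε.1]⟩
  have hmain := (hprim.tendsto.comp hsub).sub (tendsto_integral_one_sub_inv_one_add h1)
  rw [sub_zero, integral_cpow_sub_cpow_div_one_sub h0 h1] at hmain
  refine hmain.congr' ?_
  filter_upwards [hmem] with ε hε
  obtain ⟨hε0, hε1⟩ := hε
  have hint : ∀ {r : ℂ} {c : ℝ}, -1 < r.re → 0 < c → c < 1 →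
      IntervalIntegrable (fun y : ℝ => (y : ℂ) ^ r / (1 - (y : ℂ))) volume 0 c := by
    intro r c hr hc0 hc1
    simp_rw [div_eq_mul_inv]
    refine (intervalIntegral.intervalIntegrable_cpow' hr).mul_continuousOn
      (ContinuousOn.inv₀ (by fun_prop) fun y hy => ?_)
    rw [Set.uIcc_of_le hc0.le] at hy
    have : 1 - y ≠ 0 := by linarith [hy.2]
    exact_mod_cast this
  have hα : -1 < (α - 1).re := by simpa using h0
  have hβ : -1 < (-α).re := by simpa using h1
  have hε2 : 0 < 1 - ε := by linarith
  have hε3 : 1 - ε < 1 := by linarith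
  have hsplit := intervalIntegral.integral_interval_sub_left
    (hint hβ (inv_pos.2 (by linarith : 0 < 1 + ε)) (inv_lt_one_of_one_lt₀ (by linarith)))
    (hint hβ hε2 hε3)
  rw [integral_Ioi_cpow_div_one_sub α (by linarith : 1 ≤ 1 + ε), ← hsplit]
  simp only [Function.comp_apply, sub_div]
  rw [intervalIntegral.integral_sub (hint hα hε2 hε3) (hint hβ hε2 hε3)]
  ring
end
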